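/- arXiv:2211.12160 — 6 statements merged into one kernel-verified Lean document; each statement's English description precedes it below -/
import Mathlib

section
/- Suppose r, s are positive integers with r² − s²·D₁ = ±1 (i.e., r + s√D₁ is a unit > 1 of ℤ[√D₁]), and set t = gcd(r, q). Then r/t and s·q/t are coprime positive integers and (r/t)/(s·q/t) is a convergent of the continued fraction expansion of √(D/Q); that is, there is an index k with r_k = r/t and s_k = s·q/t. -/
/-- A form of Legendre's criterion: if `A` and `B` are coprime, `B ≤ A`, `1 < ξ` and
`|ξ² B² - A²| ≤ 1`, then `A / B` is a convergent of the continued fraction of `ξ`. -/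
theorem exists_convs_eq_of_abs_sq_sub_sq_le_one {ξ : ℝ} (hξ : 1 < ξ) {A B : ℕ} (hB : 0 < B)
    (hBA : B ≤ A) (hcop : Nat.Coprime A B)
    (h : |(B * ξ) ^ 2 - (A : ℝ) ^ 2| ≤ 1) :
    ∃ k : ℕ, (GenContFract.of ξ).convs k = (A : ℝ) / (B : ℝ) := by
  have hB' : (0 : ℝ) < B := by exact_mod_cast hB
  have hBA' : (B : ℝ) ≤ A := by exact_mod_cast hBA
  have hden : ((A : ℚ) / (B : ℚ)).den = B := by
    have := Rat.den_div_eq_of_coprime (a := (A : ℤ)) (b := (B : ℤ)) (by exact_mod_cast hB)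
      (by simpa using hcop)
    simpa only [Int.cast_natCast, Nat.cast_inj] using this
  have hsum : 2 * (B : ℝ) < B * ξ + A := by nlinarith
  have hprod : |B * ξ - A| * (B * ξ + A) ≤ 1 := by
    rwa [sq_sub_sq, abs_mul, abs_of_pos (by linarith), mul_comm] at h
  have hlt : |B * ξ - A| * (2 * B) < 1 := by
    rcases (abs_nonneg (B * ξ - A)).eq_or_lt with h0 | h0
    · rw [← h0]; norm_num
    · nlinarith
  obtain ⟨k, hk⟩ := Real.exists_convs_eq_rat (ξ := ξ) (q := (A : ℚ) / (B : ℚ)) (by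
    rw [hden]
    push_cast
    have heq : ξ - A / B = (B * ξ - A) / B := by field_simp
    rw [heq, abs_div, abs_of_pos hB', div_lt_div_iff₀ hB' (by positivity)]
    nlinarith)
  exact ⟨k, by rw [hk]; push_cast; rfl⟩


/-- In the setting `gcd(D,Q) = 1`, `Q < D`, `D/Q` not a square of a rational, `q` the
smallest positive divisor of `Q` with `Q ∣ q²`, `D₁ = D·q²/Q`: if `r, s` are positive
integers with `r² − s²·D₁ = ±1` and `t = gcd(r, q)`, then `r/t` and `s·q/t` are coprime
positive integers and `(r/t)/(s·q/t)` is a convergent of the continued fraction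
expansion of `√(D/Q)`. -/
theorem stmt_1 (D Q : ℕ) (hD : 0 < D) (hQ : 0 < Q) (hQD : Q < D)
    (hcop : Nat.Coprime D Q)
    (hns : ¬ ∃ a : ℚ, a ^ 2 = (D : ℚ) / Q)
    (q : ℕ) (hq0 : 0 < q) (hqQ : q ∣ Q) (hQq : Q ∣ q ^ 2)
    (hqmin : ∀ q' : ℕ, 0 < q' → q' ∣ Q → Q ∣ q' ^ 2 → q ≤ q')
    (D₁ : ℕ) (hD₁ : Q * D₁ = D * q ^ 2)
    (r s : ℕ) (hr : 0 < r) (hs : 0 < s)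
    (hunit : (r : ℤ) ^ 2 - (s : ℤ) ^ 2 * (D₁ : ℤ) = 1 ∨
             (r : ℤ) ^ 2 - (s : ℤ) ^ 2 * (D₁ : ℤ) = -1)
    (t : ℕ) (ht : t = Nat.gcd r q) :
    0 < r / t ∧ 0 < s * q / t ∧ Nat.Coprime (r / t) (s * q / t) ∧
      ∃ k : ℕ, (GenContFract.of (Real.sqrt ((D : ℝ) / (Q : ℝ)))).convs k
        = ((r / t : ℕ) : ℝ) / ((s * q / t : ℕ) : ℝ) := by
  have htr : t ∣ r := ht ▸ Nat.gcd_dvd_left r q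
  have htq : t ∣ q := ht ▸ Nat.gcd_dvd_right r q
  have ht0 : 0 < t := Nat.pos_of_dvd_of_pos htr hr
  have hrs : Nat.Coprime r s := by
    rw [← Nat.isCoprime_iff_coprime]
    rcases hunit with h | h
    · exact ⟨r, -(s * D₁), by linarith⟩
    · exact ⟨-r, s * D₁, by linarith⟩
  have hcopt : Nat.Coprime (r / t) (q / t) := by
    subst ht
    exact Nat.coprime_div_gcd_div_gcd ht0
  obtain ⟨a, rfl⟩ := htr
  obtain ⟨b, rfl⟩ := htq
  have hdiv : s * (t * b) / t = s * b := by
    rw [mul_left_comm, Nat.mul_div_cancel_left _ ht0]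
  rw [Nat.mul_div_cancel_left _ ht0, Nat.mul_div_cancel_left _ ht0] at hcopt
  rw [Nat.mul_div_cancel_left _ ht0, hdiv]
  have ha : 0 < a := Nat.pos_of_mul_pos_left hr
  have hb : 0 < b := Nat.pos_of_mul_pos_left hq0
  have hcopab : Nat.Coprime a (s * b) := (Nat.Coprime.coprime_mul_left hrs).mul_right hcopt
  refine ⟨ha, by positivity, hcopab, ?_⟩
  have hD₁q : (t * b) ^ 2 + 1 ≤ D₁ := by
    by_contra! hlt
    nlinarith [Nat.mul_le_mul_left Q (Nat.lt_succ_iff.mp hlt), pow_pos hq0 2]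
  have hle : s * b ≤ a := by
    have h1 : s ^ 2 * ((t * b) ^ 2 + 1) ≤ s ^ 2 * D₁ := Nat.mul_le_mul_left _ hD₁q
    have h2 : s ^ 2 * D₁ ≤ (t * a) ^ 2 + 1 := by
      zify
      push_cast at hunit
      rcases hunit with h | h <;> linarith
    have h3 : (t * (s * b)) ^ 2 ≤ (t * a) ^ 2 := by nlinarith [pow_pos hs 2]
    exact Nat.le_of_mul_le_mul_left ((Nat.pow_le_pow_iff_left two_ne_zero).mp h3) ht0
  have hQ' : (0 : ℝ) < Q := by exact_mod_cast hQ
  have hξ : 1 < Real.sqrt ((D : ℝ) / Q) := by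
    rw [Real.lt_sqrt zero_le_one, one_pow, one_lt_div hQ']
    exact_mod_cast hQD
  refine exists_convs_eq_of_abs_sq_sub_sq_le_one hξ (by positivity) hle hcopab ?_
  have hD₁' : (D : ℝ) / Q * (t * b) ^ 2 = D₁ := by
    have : (Q : ℝ) * D₁ = D * (t * b) ^ 2 := by exact_mod_cast hD₁
    field_simp
    linarith
  have hunit' : |(t : ℝ) ^ 2 * (((s * b : ℕ) * Real.sqrt ((D : ℝ) / Q)) ^ 2 - (a : ℝ) ^ 2)| = 1 := by
    have hxx : (t : ℝ) ^ 2 * (((s * b : ℕ) * Real.sqrt ((D : ℝ) / Q)) ^ 2 - (a : ℝ) ^ 2)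
        = -((t * a) ^ 2 - s ^ 2 * D₁) := by
      rw [mul_pow, Real.sq_sqrt (by positivity), ← hD₁']
      push_cast
      ring
    rw [hxx, abs_neg]
    rcases hunit with h | h
    · have : ((t : ℝ) * a) ^ 2 - s ^ 2 * D₁ = 1 := by exact_mod_cast h
      rw [this, abs_one]
    · have : ((t : ℝ) * a) ^ 2 - s ^ 2 * D₁ = -1 := by exact_mod_cast h
      rw [this, abs_neg, abs_one]
  rw [abs_mul, abs_of_nonneg (by positivity)] at hunit'
  have ht1 : (1 : ℝ) ≤ (t : ℝ) ^ 2 := by exact_mod_cast Nat.one_le_pow 2 t ht0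
  nlinarith [abs_nonneg (((s * b : ℕ) * Real.sqrt ((D : ℝ) / Q)) ^ 2 - (a : ℝ) ^ 2)]
end

section
/- Suppose r, s are positive integers with r² − s²·D₁ = ±1 and t = gcd(r, q). Then t² divides Q. -/
/-- In the setting `gcd(D,Q) = 1`, `Q < D`, `D/Q` not a square of a rational, `q` the
smallest positive divisor of `Q` with `Q ∣ q²`, `D₁ = D·q²/Q`: if `r, s` are positive
integers with `r² − s²·D₁ = ±1` and `t = gcd(r, q)`, then `t²` divides `Q`. -/
theorem stmt_2 (D Q : ℕ) (hD : 0 < D) (hQ : 0 < Q) (hQD : Q < D)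
    (hcop : Nat.Coprime D Q)
    (hns : ¬ ∃ a : ℚ, a ^ 2 = (D : ℚ) / Q)
    (q : ℕ) (hq0 : 0 < q) (hqQ : q ∣ Q) (hQq : Q ∣ q ^ 2)
    (hqmin : ∀ q' : ℕ, 0 < q' → q' ∣ Q → Q ∣ q' ^ 2 → q ≤ q')
    (D₁ : ℕ) (hD₁ : Q * D₁ = D * q ^ 2)
    (r s : ℕ) (hr : 0 < r) (hs : 0 < s)
    (hunit : (r : ℤ) ^ 2 - (s : ℤ) ^ 2 * (D₁ : ℤ) = 1 ∨
             (r : ℤ) ^ 2 - (s : ℤ) ^ 2 * (D₁ : ℤ) = -1)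
    (t : ℕ) (ht : t = Nat.gcd r q) :
    t ^ 2 ∣ Q := by
  obtain ⟨k, hk⟩ := hQq
  have hD₁k : D₁ = D * k := by
    apply Nat.eq_of_mul_eq_mul_left hQ
    rw [hD₁, hk]
    ring
  have htr : t ∣ r := ht ▸ Nat.gcd_dvd_left r q
  have htq : t ∣ q := ht ▸ Nat.gcd_dvd_right r q
  have hrk : IsCoprime (r : ℤ) (k : ℤ) := by
    rw [hD₁k] at hunit
    push_cast at hunit
    rcases hunit with h | h
    · exact ⟨r, -(s ^ 2 * D), by linear_combination h⟩
    · exact ⟨-r, s ^ 2 * D, by linear_combination -h⟩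
  have htk : Nat.Coprime (t ^ 2) k :=
    ((Nat.isCoprime_iff_coprime.mp hrk).coprime_dvd_left htr).pow_left 2
  exact htk.dvd_of_dvd_mul_right (hk ▸ pow_dvd_pow_of_dvd htq 2)
end

section
/- Suppose r, s are positive integers with r² − s²·D₁ = ±1, t = gcd(r, q), and let k be the index with r_k = r/t, s_k = s·q/t. Then Q_{k+1} = Q/t², where Q_{k+1} is the denominator appearing in the (k+1)-th complete quotient x_{k+1} = (√(DQ) + P_{k+1})/Q_{k+1} of √(D/Q). -/
/-- The sequence of complete quotients of `x`: `cq x 0 = x`,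
`cq x (j+1) = 1 / (cq x j - ⌊cq x j⌋)`. -/
noncomputable def cq (x : ℝ) : ℕ → ℝ
  | 0 => x
  | j + 1 => (Int.fract (cq x j))⁻¹

theorem cq_succ_eq_cq_inv_fract (x : ℝ) (j : ℕ) : cq x (j + 1) = cq (Int.fract x)⁻¹ j := by
  induction j with
  | zero => rfl
  | succ j ih =>
    change (Int.fract (cq x (j + 1)))⁻¹ = (Int.fract (cq (Int.fract x)⁻¹ j))⁻¹
    rw [ih]

/-- Numerators and denominators of two consecutive convergents of an irrational `x > 1`, with
their determinant and their relation to the complete quotients. -/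
theorem exists_convs_eq_div_and_cq {x : ℝ} (hx : Irrational x) (h1 : 1 < x) (k : ℕ) :
    ∃ a b a' b' : ℤ, 0 < a ∧ 0 < b ∧ (GenContFract.of x).convs k = (a : ℝ) / b ∧
      x * (b * cq x (k + 1) + b') = a * cq x (k + 1) + a' ∧
      (a * b' - a' * b = 1 ∨ a * b' - a' * b = -1) := by
  induction k generalizing x with
  | zero =>
    have hf : Int.fract x ≠ 0 := by
      rw [Int.fract, sub_ne_zero]
      exact hx.ne_int _
    refine ⟨⌊x⌋, 1, 1, 0, Int.floor_pos.2 h1.le, one_pos, by simp, ?_, by simp⟩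
    change x * (((1 : ℤ) : ℝ) * (Int.fract x)⁻¹ + ((0 : ℤ) : ℝ))
      = (⌊x⌋ : ℝ) * (Int.fract x)⁻¹ + ((1 : ℤ) : ℝ)
    field_simp
    push_cast
    linarith [Int.floor_add_fract x]
  | succ k ih =>
    have hf : Int.fract x ≠ 0 := by
      rw [Int.fract, sub_ne_zero]
      exact hx.ne_int _
    have hf0 : 0 < Int.fract x := lt_of_le_of_ne (Int.fract_nonneg x) hf.symm
    have hz : Irrational (Int.fract x)⁻¹ := (hx.sub_intCast ⌊x⌋).inv
    obtain ⟨a, b, a', b', ha, hb, hc, hy, hdet⟩ :=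
      ih hz ((one_lt_inv₀ hf0).2 (Int.fract_lt_one x))
    have hfl : 0 < ⌊x⌋ := Int.floor_pos.2 h1.le
    refine ⟨⌊x⌋ * a + b, a, ⌊x⌋ * a' + b', a', by positivity, ha, ?_, ?_, ?_⟩
    · have : (a : ℝ) ≠ 0 := by exact_mod_cast ha.ne'
      rw [GenContFract.convs_succ, hc]
      push_cast
      field_simp
    · rw [cq_succ_eq_cq_inv_fract]
      generalize cq (Int.fract x)⁻¹ (k + 1) = y at hy ⊢
      field_simp at hy
      push_cast
      linear_combination (-1 : ℝ) * hy - (a * y + a') * Int.floor_add_fract x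
    · rcases hdet with h | h
      · right; linear_combination -h
      · left; linear_combination -h

/-- Two fractions in lowest terms with positive numerators that are equal
have the same numerators and denominators. -/
theorem eq_and_eq_of_mul_eq_mul_of_isCoprime {a b c d : ℤ} (ha : 0 < a) (hc : 0 < c)
    (hab : IsCoprime a b) (hcd : IsCoprime c d)
    (h : a * d = c * b) : a = c ∧ b = d := by
  have h1 : a ∣ c := hab.dvd_of_dvd_mul_right (Dvd.intro _ h)
  have h2 : c ∣ a := hcd.dvd_of_dvd_mul_right (Dvd.intro _ h.symm)
  have hac : a = c := Int.dvd_antisymm ha.le hc.le h1 h2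
  subst hac
  exact ⟨rfl, (mul_left_cancel₀ ha.ne' h).symm⟩

/-- Comparing coefficients of an irrational number `w` in `u * w + v = 0`. -/
theorem Irrational.eq_zero_of_int_mul_add_int {w : ℝ} (hw : Irrational w) {u v : ℤ}
    (h : (u : ℝ) * w + v = 0) : u = 0 ∧ v = 0 := by
  have hu : u = 0 := by
    by_contra hu
    exact ((hw.intCast_mul hu).add_intCast v).ne_zero h
  subst hu
  exact ⟨rfl, by simpa using h⟩

/-- If a complete quotient `(√(DQ) + P) / m` of `√(D/Q)` follows the convergent `a / b`, then
`Q a² - D b² = ± m`. -/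
theorem mul_sq_sub_mul_sq_eq_det_mul {D Q m : ℕ} (hQ : 0 < Q) (hm : 0 < m) {P a b a' b' : ℤ}
    (hw : Irrational √((D : ℝ) * Q))
    (h : √((D : ℝ) / Q) * (b * ((√((D : ℝ) * Q) + P) / m) + b')
      = a * ((√((D : ℝ) * Q) + P) / m) + a') :
    (Q : ℤ) * a ^ 2 - D * b ^ 2 = (a * b' - a' * b) * m := by
  have hQ' : (Q : ℝ) ≠ 0 := by positivity
  have hm' : (m : ℝ) ≠ 0 := by positivity
  have hx : √((D : ℝ) / Q) = √((D : ℝ) * Q) / Q := by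
    rw [show (D : ℝ) / Q = D * Q / (Q : ℝ) ^ 2 by field_simp, Real.sqrt_div (by positivity),
      Real.sqrt_sq (by positivity)]
  have hsq : √((D : ℝ) * Q) ^ 2 = D * Q := Real.sq_sqrt (by positivity)
  rw [hx] at h
  generalize √((D : ℝ) * Q) = w at *
  field_simp at h
  obtain ⟨h1, h2⟩ := hw.eq_zero_of_int_mul_add_int
    (u := b * P + b' * m - Q * a) (v := Q * (D * b - a * P - a' * m)) (by
      push_cast
      linear_combination h - (b : ℝ) * hsq)
  have h3 : (D : ℤ) * b - a * P - a' * m = 0 :=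
    (mul_eq_zero.1 h2).resolve_left (by exact_mod_cast hQ.ne')
  linear_combination -a * h1 - b * h3

/-- In the usual setting, let `r, s` be positive integers with `r² − s²·D₁ = ±1`,
`t = gcd(r, q)`, and let `k` be the index with `r_k = r/t`, `s_k = s·q/t`.
Then `Q_{k+1} = Q/t²`, where `Q_{k+1}` is the denominator of the `(k+1)`-th complete
quotient `x_{k+1} = (√(DQ) + P_{k+1}) / Q_{k+1}` of `√(D/Q)`. -/
theorem stmt_3 (D Q : ℕ) (hD : 0 < D) (hQ : 0 < Q) (hQD : Q < D)
    (hcop : Nat.Coprime D Q)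
    (hns : ¬ ∃ a : ℚ, a ^ 2 = (D : ℚ) / Q)
    (q : ℕ) (hq0 : 0 < q) (hqQ : q ∣ Q) (hQq : Q ∣ q ^ 2)
    (hqmin : ∀ q' : ℕ, 0 < q' → q' ∣ Q → Q ∣ q' ^ 2 → q ≤ q')
    (D₁ : ℕ) (hD₁ : Q * D₁ = D * q ^ 2)
    (r s : ℕ) (hr : 0 < r) (hs : 0 < s)
    (hunit : (r : ℤ) ^ 2 - (s : ℤ) ^ 2 * (D₁ : ℤ) = 1 ∨
             (r : ℤ) ^ 2 - (s : ℤ) ^ 2 * (D₁ : ℤ) = -1)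
    (t : ℕ) (ht : t = Nat.gcd r q)
    (k : ℕ)
    (hk : (GenContFract.of (Real.sqrt ((D : ℝ) / (Q : ℝ)))).convs k
        = ((r / t : ℕ) : ℝ) / ((s * q / t : ℕ) : ℝ)) :
    ∀ (P : ℤ) (Qk : ℕ), 0 < Qk →
      cq (Real.sqrt ((D : ℝ) / (Q : ℝ))) (k + 1)
        = (Real.sqrt ((D : ℝ) * (Q : ℝ)) + (P : ℝ)) / (Qk : ℝ) →
      Qk * t ^ 2 = Q := by
  intro P m hm hcq
  have hx : Irrational √((D : ℝ) / Q) := by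
    rintro ⟨a, ha⟩
    refine hns ⟨a, ?_⟩
    have : (a : ℝ) ^ 2 = (D : ℝ) / Q := by rw [ha, Real.sq_sqrt (by positivity)]
    apply Rat.cast_injective (α := ℝ)
    push_cast
    exact this
  have hw : Irrational √((D : ℝ) * Q) := by
    have : √((D : ℝ) * Q) = √((D : ℝ) / Q) * (Q : ℕ) := by
      rw [show (D : ℝ) * Q = D / Q * (Q : ℝ) ^ 2 by field_simp, Real.sqrt_mul (by positivity),
        Real.sqrt_sq (by positivity)]
    rw [this]
    exact hx.mul_natCast hQ.ne'
  have h1 : 1 < √((D : ℝ) / Q) := by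
    rw [Real.lt_sqrt zero_le_one, one_pow, one_lt_div (by positivity)]
    exact_mod_cast hQD
  obtain ⟨a, b, a', b', ha, hb, hc, hy, hdet⟩ := exists_convs_eq_div_and_cq hx h1 k
  rw [hcq] at hy
  have hm_eq := mul_sq_sub_mul_sq_eq_det_mul hQ hm hw hy
  have ht0 : 0 < t := ht ▸ Nat.gcd_pos_of_pos_left q hr
  obtain ⟨c, hrc⟩ : t ∣ r := ht ▸ Nat.gcd_dvd_left r q
  obtain ⟨d, hqd⟩ : t ∣ q := ht ▸ Nat.gcd_dvd_right r q
  have hc0 : 0 < c := Nat.pos_of_ne_zero (by rintro rfl; simp [hrc] at hr)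
  have hd0 : 0 < d := Nat.pos_of_ne_zero (by rintro rfl; simp [hqd] at hq0)
  have hcd : IsCoprime (c : ℤ) d := by
    refine Nat.isCoprime_iff_coprime.2 (Nat.eq_of_mul_eq_mul_left ht0 ?_)
    rw [← Nat.gcd_mul_left, ← hrc, ← hqd, ← ht, mul_one]
  have hcs : IsCoprime (c : ℤ) s := by
    have hrc' : (r : ℤ) = t * c := by exact_mod_cast hrc
    rcases hunit with h | h
    · exact ⟨t * r, -(s * D₁), by linear_combination h - (r : ℤ) * hrc'⟩
    · exact ⟨-(t * r), s * D₁, by linear_combination -h + (r : ℤ) * hrc'⟩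
  have hdiv : s * q / t = s * d := by
    rw [hqd, mul_left_comm, Nat.mul_div_cancel_left _ ht0]
  have hcross : a * ((s * d : ℕ) : ℤ) = (c : ℤ) * b := by
    rw [hc, hdiv, hrc, Nat.mul_div_cancel_left _ ht0, div_eq_div_iff] at hk
    · exact_mod_cast hk
    · exact_mod_cast hb.ne'
    · exact_mod_cast (Nat.mul_pos hs hd0).ne'
  have hab : IsCoprime a b := by
    rcases hdet with h | h
    · exact ⟨b', -a', by linear_combination h⟩
    · exact ⟨-b', a', by linear_combination -h⟩
  obtain ⟨rfl, rfl⟩ := eq_and_eq_of_mul_eq_mul_of_isCoprime ha (by exact_mod_cast hc0)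
    hab (by push_cast; exact hcs.mul_right hcd) hcross
  have hD₁' : (Q : ℤ) * D₁ = D * q ^ 2 := by exact_mod_cast hD₁
  have hnorm : (Q : ℤ) * ((r : ℤ) ^ 2 - (s : ℤ) ^ 2 * D₁)
      = t ^ 2 * ((Q : ℤ) * (c : ℤ) ^ 2 - D * ((s * d : ℕ) : ℤ) ^ 2) := by
    have hrc' : (r : ℤ) = t * c := by exact_mod_cast hrc
    have hqd' : (q : ℤ) = t * d := by exact_mod_cast hqd
    rw [hqd'] at hD₁'
    rw [hrc']
    push_cast
    linear_combination -(s : ℤ) ^ 2 * hD₁'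
  rw [hm_eq] at hnorm
  have hpos : (0 : ℤ) < m * t ^ 2 := by positivity
  have hQ' : (0 : ℤ) < Q := by exact_mod_cast hQ
  zify
  rcases hunit with h | h <;> rcases hdet with h' | h' <;> rw [h, h'] at hnorm <;> linarith
end

section
/- Suppose r, s are positive integers with r² − s²·D₁ = ±1. Then r + s√D₁ lies in the subring ℤ[√D₂] of ℝ (where D₂ = DQ) if and only if Q divides s·q. -/
/-- Every element of the subring generated by a square root `x` of an integer `m`
has the form `a + b * x` with integers `a`, `b`. -/
lemma exists_eq_add_mul_of_mem_closure_of_sq_eq {R : Type*} [CommRing R] {x : R} {m : ℤ}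
    (hx : x ^ 2 = m) {y : R} (hy : y ∈ Subring.closure {x}) :
    ∃ a b : ℤ, y = a + b * x := by
  induction hy using Subring.closure_induction with
  | mem y hy => exact ⟨0, 1, by simp [Set.mem_singleton_iff.mp hy]⟩
  | zero => exact ⟨0, 0, by simp⟩
  | one => exact ⟨1, 0, by simp⟩
  | add y z _ _ ihy ihz =>
    obtain ⟨a, b, rfl⟩ := ihy
    obtain ⟨c, d, rfl⟩ := ihz
    exact ⟨a + c, b + d, by push_cast; ring⟩
  | neg y _ ihy =>
    obtain ⟨a, b, rfl⟩ := ihy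
    exact ⟨-a, -b, by push_cast; ring⟩
  | mul y z _ _ ihy ihz =>
    obtain ⟨a, b, rfl⟩ := ihy
    obtain ⟨c, d, rfl⟩ := ihz
    refine ⟨a * c + b * d * m, a * d + b * c, ?_⟩
    push_cast
    linear_combination (b * d : R) * hx

/-- Integer coordinates with respect to `1` and an irrational number are unique. -/
lemma Irrational.eq_of_intCast_add_mul_eq {x : ℝ} (hx : Irrational x) {a b c d : ℤ}
    (h : (a : ℝ) + b * x = c + d * x) : b = d := by
  by_contra hbd
  have hirr : Irrational (((b - d : ℤ) : ℝ) * x) := hx.intCast_mul (sub_ne_zero.mpr hbd)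
  refine hirr ⟨((c - a : ℤ) : ℚ), ?_⟩
  push_cast
  linear_combination -h


/-- In the setting `gcd(D,Q) = 1`, `Q < D`, `D/Q` not a square of a rational, `q` the
smallest positive divisor of `Q` with `Q ∣ q²`, `D₁ = D·q²/Q`, `D₂ = DQ`: if `r, s`
are positive integers with `r² − s²·D₁ = ±1`, then `r + s√D₁` lies in the subring
`ℤ[√D₂]` of `ℝ` if and only if `Q` divides `s·q`. -/
theorem stmt_5 (D Q : ℕ) (hD : 0 < D) (hQ : 0 < Q) (hQD : Q < D)
    (hcop : Nat.Coprime D Q)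
    (hns : ¬ ∃ a : ℚ, a ^ 2 = (D : ℚ) / Q)
    (q : ℕ) (hq0 : 0 < q) (hqQ : q ∣ Q) (hQq : Q ∣ q ^ 2)
    (hqmin : ∀ q' : ℕ, 0 < q' → q' ∣ Q → Q ∣ q' ^ 2 → q ≤ q')
    (D₁ : ℕ) (hD₁ : Q * D₁ = D * q ^ 2)
    (r s : ℕ) (hr : 0 < r) (hs : 0 < s)
    (hunit : (r : ℤ) ^ 2 - (s : ℤ) ^ 2 * (D₁ : ℤ) = 1 ∨
             (r : ℤ) ^ 2 - (s : ℤ) ^ 2 * (D₁ : ℤ) = -1) :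
    (r : ℝ) + (s : ℝ) * Real.sqrt (D₁ : ℝ)
      ∈ Subring.closure {Real.sqrt ((D : ℝ) * (Q : ℝ))} ↔ Q ∣ s * q := by
  obtain ⟨k, rfl⟩ := hqQ
  have hk : 0 < k := Nat.pos_of_mul_pos_left hQ
  have hD₂ : D * (q * k) = D₁ * k ^ 2 := by
    have h : k * D₁ = D * q := Nat.eq_of_mul_eq_mul_left hq0 (by linear_combination hD₁)
    linear_combination k * h.symm
  have hsqrt : √((D : ℝ) * ((q * k : ℕ) : ℝ)) = k * √(D₁ : ℝ) := by
    have h : (D : ℝ) * ((q * k : ℕ) : ℝ) = D₁ * (k : ℝ) ^ 2 := by exact_mod_cast hD₂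
    rw [h, Real.sqrt_mul (Nat.cast_nonneg _), Real.sqrt_sq (Nat.cast_nonneg _), mul_comm]
  have hirr : Irrational √(D₁ : ℝ) := by
    rintro ⟨a, ha⟩
    refine hns ⟨a / q, ?_⟩
    have ha2 : a ^ 2 = (D₁ : ℚ) := by
      have h := Real.sq_sqrt (Nat.cast_nonneg (α := ℝ) D₁)
      rw [← ha] at h
      exact_mod_cast h
    have hD₁' : ((q * k : ℕ) : ℚ) * D₁ = D * (q : ℚ) ^ 2 := by exact_mod_cast hD₁
    have hq' : (q : ℚ) ≠ 0 := by positivity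
    have hQ' : ((q * k : ℕ) : ℚ) ≠ 0 := by positivity
    rw [div_pow, ha2, div_eq_div_iff (pow_ne_zero 2 hq') hQ']
    linear_combination hD₁'
  rw [hsqrt, mul_comm q k, Nat.mul_dvd_mul_iff_right hq0]
  constructor
  · intro h
    have hx : ((k : ℝ) * √(D₁ : ℝ)) ^ 2 = ((k ^ 2 * D₁ : ℤ) : ℝ) := by
      rw [mul_pow, Real.sq_sqrt (Nat.cast_nonneg _)]
      push_cast
      rfl
    obtain ⟨a, b, hab⟩ := exists_eq_add_mul_of_mem_closure_of_sq_eq hx h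
    have hs' : (s : ℤ) = b * k := by
      refine hirr.eq_of_intCast_add_mul_eq (a := r) (c := a) ?_
      push_cast
      linear_combination hab
    exact Int.natCast_dvd_natCast.mp ⟨b, by rw [hs', mul_comm]⟩
  · rintro ⟨t, rfl⟩
    have h : (((k * t : ℕ) : ℝ)) * √(D₁ : ℝ) = t * (k * √(D₁ : ℝ)) := by
      push_cast
      ring
    rw [h]
    exact add_mem (natCast_mem _ _)
      (mul_mem (natCast_mem _ _) (Subring.subset_closure (Set.mem_singleton _)))
end

section
/- Suppose r, s are positive integers with r² − s²·D₂ = ±1 (i.e., r + s√D₂ is a unit > 1 of ℤ[√D₂], D₂ = DQ). Then gcd(r, Q) = 1, and (r, sQ) is a convergent of √(D/Q): there is an index k with r_k = r, s_k = sQ, and moreover r_k² − s_k²·(D/Q) = ±1. -/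
/-- Let `D, Q` be natural numbers with `gcd(D,Q) = 1`, `Q < D`, `D/Q` not a square of a
rational, and `D₂ = DQ`. If `r, s` are positive integers with `r² − s²·D₂ = ±1`,
then `gcd(r, Q) = 1` and `(r, sQ)` is a convergent of `√(D/Q)` (in lowest terms):
there is an index `k` with `r_k = r`, `s_k = sQ`; moreover
`r_k² − s_k²·(D/Q) = ±1`. -/
theorem stmt_6 (D Q : ℕ) (hD : 0 < D) (hQ : 0 < Q) (hQD : Q < D)
    (hcop : Nat.Coprime D Q)
    (hns : ¬ ∃ a : ℚ, a ^ 2 = (D : ℚ) / Q)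
    (r s : ℕ) (hr : 0 < r) (hs : 0 < s)
    (hunit : (r : ℤ) ^ 2 - (s : ℤ) ^ 2 * ((D : ℤ) * (Q : ℤ)) = 1 ∨
             (r : ℤ) ^ 2 - (s : ℤ) ^ 2 * ((D : ℤ) * (Q : ℤ)) = -1) :
    Nat.Coprime r Q ∧ Nat.Coprime r (s * Q) ∧
      (∃ k : ℕ, (GenContFract.of (Real.sqrt ((D : ℝ) / (Q : ℝ)))).convs k
        = (r : ℝ) / ((s * Q : ℕ) : ℝ)) ∧
      ((r : ℚ) ^ 2 - ((s * Q : ℕ) : ℚ) ^ 2 * ((D : ℚ) / (Q : ℚ)) = 1 ∨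
       (r : ℚ) ^ 2 - ((s * Q : ℕ) : ℚ) ^ 2 * ((D : ℚ) / (Q : ℚ)) = -1) := by
  have hcopS : Nat.Coprime r (s * Q) := by
    rw [← Nat.isCoprime_iff_coprime]
    push_cast
    rcases hunit with h | h
    · exact ⟨r, -(s * D), by linear_combination h⟩
    · exact ⟨-r, s * D, by linear_combination -h⟩
  have hS : 0 < s * Q := Nat.mul_pos hs hQ
  have hle : s * Q ≤ r := by
    have h1 : (s : ℤ) ^ 2 * (D * Q) ≥ s ^ 2 * ((Q + 1) * Q) := by
      gcongr
      exact_mod_cast hQD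
    have h2 : (1 : ℤ) ≤ s ^ 2 * Q := by
      exact_mod_cast Nat.succ_le_of_lt (by positivity : 0 < s ^ 2 * Q)
    have h3 : ((s : ℤ) * Q) ^ 2 ≤ (r : ℤ) ^ 2 := by
      rcases hunit with h | h <;> linarith
    exact_mod_cast (abs_le.mp (abs_le_of_sq_le_sq h3 (by positivity))).2
  refine ⟨hcopS.coprime_mul_left_right, hcopS, ?_, ?_⟩
  · have hQ' : (0 : ℝ) < Q := by exact_mod_cast hQ
    set ξ : ℝ := Real.sqrt ((D : ℝ) / (Q : ℝ)) with hξ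
    have hξsq : ξ ^ 2 = (D : ℝ) / Q := Real.sq_sqrt (by positivity)
    have hξ1 : 1 < ξ := by
      rw [hξ, Real.lt_sqrt (by norm_num), one_pow, one_lt_div hQ']
      exact_mod_cast hQD
    set S : ℝ := ((s * Q : ℕ) : ℝ) with hSdef
    have hS' : 0 < S := Nat.cast_pos.mpr hS
    have hle' : S ≤ r := Nat.cast_le.mpr hle
    have hprod : S ^ 2 * ξ ^ 2 = (s : ℝ) ^ 2 * (D * Q) := by
      rw [hξsq, hSdef]
      push_cast
      field_simp
    have hnorm : |S * ξ - r| * (r + S * ξ) = 1 := by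
      have hpos : 0 < (r : ℝ) + S * ξ := by positivity
      rw [← abs_of_pos hpos, ← abs_mul, abs_eq zero_le_one]
      rcases hunit with h | h
      · right
        have h' : (r : ℝ) ^ 2 - (s : ℝ) ^ 2 * (D * Q) = 1 := by exact_mod_cast h
        linear_combination hprod - h'
      · left
        have h' : (r : ℝ) ^ 2 - (s : ℝ) ^ 2 * (D * Q) = -1 := by exact_mod_cast h
        linear_combination hprod - h'
    have hden : ((r : ℚ) / ((s * Q : ℕ) : ℚ)).den = s * Q := by
      have := Rat.den_div_eq_of_coprime (a := (r : ℤ)) (b := ((s * Q : ℕ) : ℤ))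
        (by exact_mod_cast hS) (by simpa only [Int.natAbs_natCast] using hcopS)
      simp only [Int.cast_natCast] at this
      exact Nat.cast_injective this
    have happrox : |ξ - (((r : ℚ) / ((s * Q : ℕ) : ℚ) : ℚ) : ℝ)|
        < 1 / (2 * (((r : ℚ) / ((s * Q : ℕ) : ℚ)).den : ℝ) ^ 2) := by
      rw [hden, Rat.cast_div, Rat.cast_natCast, Rat.cast_natCast, ← hSdef]
      have heq : ξ - r / S = (S * ξ - r) / S := by field_simp
      rw [heq, abs_div, abs_of_pos hS', div_lt_div_iff₀ hS' (by positivity)]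
      have hlarge : 2 * S < r + S * ξ := by nlinarith
      have hne : 0 < |S * ξ - r| := by
        refine (abs_nonneg _).lt_of_ne fun h => ?_
        rw [← h, zero_mul] at hnorm
        exact zero_ne_one hnorm
      nlinarith [mul_lt_mul_of_pos_left hlarge hne]
    obtain ⟨k, hk⟩ := Real.exists_convs_eq_rat happrox
    exact ⟨k, by rw [hk, Rat.cast_div, Rat.cast_natCast, Rat.cast_natCast]⟩
  · have hQ' : (Q : ℚ) ≠ 0 := by exact_mod_cast hQ.ne'
    have heq : ((s * Q : ℕ) : ℚ) ^ 2 * ((D : ℚ) / Q) = (s : ℚ) ^ 2 * (D * Q) := by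
      push_cast
      field_simp
    rw [heq]
    exact_mod_cast hunit
end

section
/- Let m+1 be the minimal period length of the continued fraction expansion √(D/Q) = [b₀; {b₁,…,b_m, 2b₀}], and let k = l(m+1) − 1 for some natural number l. Then Q divides s_k and r_k² − s_k²·(D/Q) = ±1; consequently, with s = s_k/Q, the number r_k + s√D₂ is a unit > 1 of ℤ[√D₂] (where D₂ = DQ), i.e., r_k² − s²·D₂ = ±1. -/
/-- The `j`-th partial quotient of the continued fraction expansion of `x`:
the floor of the `j`-th complete quotient. -/
noncomputable def pq (x : ℝ) (j : ℕ) : ℤ := ⌊cq x j⌋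

theorem cq_cq (x : ℝ) (i j : ℕ) : cq (cq x i) j = cq x (i + j) := by
  induction j with
  | zero => rfl
  | succ j ih =>
    change (Int.fract (cq (cq x i) j))⁻¹ = (Int.fract (cq x (i + j)))⁻¹
    rw [ih]

theorem pq_cq (x : ℝ) (i j : ℕ) : pq (cq x i) j = pq x (i + j) := by
  simp only [pq, cq_cq]

theorem cq_eq_pq_add_inv (x : ℝ) (j : ℕ) : cq x j = pq x j + (cq x (j + 1))⁻¹ := by
  change cq x j = ⌊cq x j⌋ + ((Int.fract (cq x j))⁻¹)⁻¹
  rw [inv_inv, Int.floor_add_fract]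

theorem convergent_eq_of_pq_eq {x y : ℝ} (h : ∀ j, pq x j = pq y j) (n : ℕ) :
    x.convergent n = y.convergent n := by
  induction n generalizing x y with
  | zero => simpa [pq, cq] using h 0
  | succ n ih =>
    have h0 : ⌊x⌋ = ⌊y⌋ := h 0
    rw [Real.convergent_succ, Real.convergent_succ, h0, ih fun j => ?_]
    simpa only [pq, cq_succ_eq_cq_inv_fract] using h (j + 1)

/-- A real number is determined by its partial quotients. -/
theorem eq_of_pq_eq {x y : ℝ} (h : ∀ j, pq x j = pq y j) : x = y := by
  refine tendsto_nhds_unique (GenContFract.of_convergence x) ?_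
  have hxy : (GenContFract.of x).convs = (GenContFract.of y).convs := funext fun n => by
    rw [Real.convs_eq_convergent, Real.convs_eq_convergent, convergent_eq_of_pq_eq h]
  rw [hxy]
  exact GenContFract.of_convergence y

theorem cq_add_eq_of_pq_periodic {x : ℝ} {i t : ℕ} (h : ∀ j, i ≤ j → pq x (j + t) = pq x j) :
    cq x (i + t) = cq x i := by
  refine eq_of_pq_eq fun j => ?_
  rw [pq_cq, pq_cq, ← h (i + j) (by omega)]
  congr 1
  omega

theorem Irrational.fract_ne_zero {x : ℝ} (hx : Irrational x) : Int.fract x ≠ 0 :=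
  (hx.sub_intCast ⌊x⌋).ne_zero

theorem Irrational.inv_fract {x : ℝ} (hx : Irrational x) : Irrational (Int.fract x)⁻¹ :=
  (hx.sub_intCast ⌊x⌋).inv

theorem Irrational.one_lt_inv_fract {x : ℝ} (hx : Irrational x) : 1 < (Int.fract x)⁻¹ := by
  exact (one_lt_inv₀ ((Int.fract_nonneg x).lt_of_ne' hx.fract_ne_zero)).2 (Int.fract_lt_one x)

/-- The `n`-th convergent `p / q` of `x > 1` irrational and the matrix of determinant `±1`
carrying the complete quotient `cq x (n + 1)` to `x`. -/
theorem exists_convergent_matrix {x : ℝ} (hx : Irrational x) (hx1 : 1 < x) (n : ℕ) :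
    ∃ p p' q q' : ℤ, 0 < p ∧ 0 < q ∧ (p * q' - q * p' = 1 ∨ p * q' - q * p' = -1) ∧
      x * (q * cq x (n + 1) + q') = p * cq x (n + 1) + p' ∧ x.convergent n = (p : ℚ) / q := by
  induction n generalizing x with
  | zero =>
    have hf := hx.fract_ne_zero
    refine ⟨⌊x⌋, 1, 1, 0, Int.floor_pos.2 hx1.le, one_pos, by simp, ?_, by simp⟩
    change x * ((1 : ℤ) * (Int.fract x)⁻¹ + (0 : ℤ)) = ⌊x⌋ * (Int.fract x)⁻¹ + (1 : ℤ)
    push_cast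
    field_simp
    linear_combination -Int.floor_add_fract x
  | succ n ih =>
    obtain ⟨p, p', q, q', hp, hq, hdet, hmul, hconv⟩ := ih hx.inv_fract hx.one_lt_inv_fract
    rw [← cq_succ_eq_cq_inv_fract] at hmul
    have hf := hx.fract_ne_zero
    have hb : 0 < ⌊x⌋ := Int.floor_pos.2 hx1.le
    refine ⟨⌊x⌋ * p + q, ⌊x⌋ * p' + q', p, p', by positivity, hp, ?_, ?_, ?_⟩
    · rcases hdet with h | h
      · right; linear_combination -h
      · left; linear_combination -h
    · have hy : x * (Int.fract x)⁻¹ = ⌊x⌋ * (Int.fract x)⁻¹ + 1 := by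
        field_simp
        linear_combination -Int.floor_add_fract x
      push_cast
      linear_combination (⌊x⌋ - x) * hmul + (q * cq x (n + 1 + 1) + q') * hy
    · have hp' : (p : ℚ) ≠ 0 := by exact_mod_cast hp.ne'
      rw [Real.convergent_succ, hconv]
      push_cast
      field_simp

theorem cq_mul_period {x : ℝ} {t : ℕ} (ht : 0 < t) (hper : ∀ j, 1 ≤ j → pq x (j + t) = pq x j)
    (hper0 : pq x t = 2 * pq x 0) {l : ℕ} (hl : 0 < l) : cq x (l * t) = pq x 0 + x := by
  induction l, hl using Nat.le_induction with
  | base =>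
    have h1 : cq x (t + 1) = cq x 1 := by
      rw [add_comm]
      exact cq_add_eq_of_pq_periodic hper
    have h0 : x = pq x 0 + (cq x 1)⁻¹ := cq_eq_pq_add_inv x 0
    rw [Nat.succ_mul, zero_mul, zero_add, cq_eq_pq_add_inv, h1, hper0]
    push_cast
    linear_combination -h0
  | succ l hl ih =>
    have hlt : 1 ≤ l * t := Nat.mul_pos hl ht
    rw [Nat.succ_mul, cq_add_eq_of_pq_periodic fun j hj => hper j (hlt.trans hj), ih]

theorem Irrational.intCast_eq_of_mul_add_eq {x : ℝ} (hx : Irrational x) {a b : ℤ} {c : ℚ}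
    (h : (a : ℝ) * x + c = b * x) : a = b := by
  by_contra hab
  refine (hx.intCast_mul (sub_ne_zero.2 hab)).ne_rat (-c) ?_
  push_cast
  linear_combination h

/-- Let `m+1` be the minimal period length of the continued fraction expansion
`√(D/Q) = [b₀; {b₁,…,b_m, 2b₀}]`, and let `k = l(m+1) − 1` for some `l ≥ 1`. Then
`Q ∣ s_k` and `r_k² − s_k²·(D/Q) = ±1`; consequently, with `s = s_k/Q`, the number
`r_k + s√D₂` is a unit `> 1` of `ℤ[√D₂]` (where `D₂ = DQ`), i.e. `r_k² − s²·D₂ = ±1`. -/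
theorem stmt_8 (D Q : ℕ) (hD : 0 < D) (hQ : 0 < Q) (hQD : Q < D)
    (hcop : Nat.Coprime D Q)
    (hns : ¬ ∃ a : ℚ, a ^ 2 = (D : ℚ) / Q)
    (m : ℕ)
    (hper : ∀ j : ℕ, 1 ≤ j →
      pq (Real.sqrt ((D : ℝ) / (Q : ℝ))) (j + m + 1) = pq (Real.sqrt ((D : ℝ) / (Q : ℝ))) j)
    (hper0 : pq (Real.sqrt ((D : ℝ) / (Q : ℝ))) (m + 1)
      = 2 * pq (Real.sqrt ((D : ℝ) / (Q : ℝ))) 0)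
    (hmin : ∀ m' : ℕ, m' < m → ¬ (∀ j : ℕ, 1 ≤ j →
      pq (Real.sqrt ((D : ℝ) / (Q : ℝ))) (j + m' + 1) = pq (Real.sqrt ((D : ℝ) / (Q : ℝ))) j))
    (l : ℕ) (hl : 0 < l) (k : ℕ) (hk : k = l * (m + 1) - 1) :
    ∀ rk sk : ℕ, 0 < rk → 0 < sk → Nat.Coprime rk sk →
      (GenContFract.of (Real.sqrt ((D : ℝ) / (Q : ℝ)))).convs k = (rk : ℝ) / (sk : ℝ) →
      Q ∣ sk ∧
      ((rk : ℚ) ^ 2 - (sk : ℚ) ^ 2 * ((D : ℚ) / (Q : ℚ)) = 1 ∨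
       (rk : ℚ) ^ 2 - (sk : ℚ) ^ 2 * ((D : ℚ) / (Q : ℚ)) = -1) ∧
      0 < sk / Q ∧
      ((rk : ℤ) ^ 2 - ((sk / Q : ℕ) : ℤ) ^ 2 * ((D : ℤ) * (Q : ℤ)) = 1 ∨
       (rk : ℤ) ^ 2 - ((sk / Q : ℕ) : ℤ) ^ 2 * ((D : ℤ) * (Q : ℤ)) = -1) := by
  intro rk sk _ hsk hrs hconv
  set x := Real.sqrt ((D : ℝ) / (Q : ℝ))
  have hQR : (0 : ℝ) < Q := by exact_mod_cast hQ
  have hQDR : (Q : ℝ) < D := by exact_mod_cast hQD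
  have hx2 : x ^ 2 = (D : ℝ) / Q := Real.sq_sqrt (by positivity)
  have hx1 : 1 < x := Real.lt_sqrt_of_sq_lt (by rw [one_pow]; exact (one_lt_div hQR).2 hQDR)
  have hirr : Irrational x := by
    rintro ⟨a, ha⟩
    refine hns ⟨a, Rat.cast_injective (α := ℝ) ?_⟩
    push_cast
    rw [ha, hx2]
  have hk1 : k + 1 = l * (m + 1) := by
    rw [hk, Nat.sub_add_cancel (Nat.mul_pos hl m.succ_pos)]
  obtain ⟨p, p', q, q', hp, hq, hdet, hmul, hpq⟩ := exists_convergent_matrix hirr hx1 k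
  rw [hk1, cq_mul_period m.succ_pos hper hper0 hl] at hmul
  set b := pq x 0
  obtain ⟨hrp, hsq⟩ : (rk : ℤ) = p ∧ (sk : ℤ) = q := by
    refine Rat.div_int_inj (by exact_mod_cast hsk) hq (by simpa using hrs) ?_ ?_
    · refine Int.isCoprime_iff_gcd_eq_one.1 ?_
      rcases hdet with h | h
      · exact ⟨q', -p', by linear_combination h⟩
      · exact ⟨-q', p', by linear_combination -h⟩
    · rw [Real.convs_eq_convergent, hpq] at hconv
      apply Rat.cast_injective (α := ℝ)
      push_cast at hconv ⊢
      exact hconv.symm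
  have hlin : q * b + q' = p := by
    refine hirr.intCast_eq_of_mul_add_eq (c := q * (D / Q) - p * b - p') ?_
    push_cast
    rw [← hx2]
    linear_combination hmul
  have hconst : q * (D : ℤ) = Q * (p * b + p') := by
    have h : (q : ℝ) * (D / Q) = p * b + p' := by
      have hlin' : (q : ℝ) * b + q' = p := by exact_mod_cast hlin
      rw [← hx2]
      linear_combination hmul - x * hlin'
    field_simp at h
    exact_mod_cast h
  have hQs : Q ∣ sk := by
    have : (Q : ℤ) ∣ (sk * D : ℕ) := ⟨p * b + p', by push_cast; rw [hsq, hconst]⟩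
    exact hcop.symm.dvd_of_dvd_mul_right (Int.natCast_dvd_natCast.1 this)
  obtain ⟨s, rfl⟩ := hQs
  have hs : Q * s / Q = s := Nat.mul_div_cancel_left s hQ
  have hnorm : (rk : ℤ) ^ 2 - (s : ℤ) ^ 2 * (D * Q) = p * q' - q * p' := by
    have hsq' : (Q : ℤ) * s = q := by exact_mod_cast hsq
    have hsD : (s : ℤ) * D = p * b + p' := by
      apply mul_left_cancel₀ (show (Q : ℤ) ≠ 0 by exact_mod_cast hQ.ne')
      rw [← hconst, ← hsq']
      ring
    rw [hrp]
    linear_combination -p * hlin - s * Q * hsD - (p * b + p') * hsq'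
  rw [← hnorm] at hdet
  have hrat : (rk : ℚ) ^ 2 - ((Q * s : ℕ) : ℚ) ^ 2 * ((D : ℚ) / Q) =
      (((rk : ℤ) ^ 2 - (s : ℤ) ^ 2 * (D * Q) : ℤ) : ℚ) := by
    have : (Q : ℚ) ≠ 0 := by exact_mod_cast hQ.ne'
    push_cast
    field_simp
  rw [hs, hrat]
  exact ⟨dvd_mul_right Q s, by exact_mod_cast hdet, Nat.pos_of_mul_pos_left hsk, hdet⟩
end
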